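/- Suppose s(n) is a real polynomial with positive degree and positive leading coefficient. Then lim_{q→1⁻} Σ_{n≥0} (−1)^n q^{s(n)} = 1/2, where the limit is taken over q ∈ (0,1). -/

import Mathlib

open Filter Topology

lemma aux_pos (p : Polynomial ℝ) (h : 0 < p.leadingCoeff) :
    ∀ᶠ x : ℝ in atTop, 0 < p.eval x := by
  have h0 : p ≠ 0 := by rintro rfl; simp at h
  have h1 := Polynomial.div_tendsto_leadingCoeff_div_of_degree_eq p (Polynomial.X ^ p.natDegree)
    (by rw [Polynomial.degree_X_pow, Polynomial.degree_eq_natDegree h0])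
  have h2 : 0 < p.leadingCoeff / (Polynomial.X ^ p.natDegree : Polynomial ℝ).leadingCoeff := by
    simpa using h
  filter_upwards [h1.eventually (lt_mem_nhds h2), eventually_gt_atTop 0] with x hx hx0
  have h3 : 0 < (Polynomial.X ^ p.natDegree : Polynomial ℝ).eval x := by
    simp; positivity
  exact (div_pos_iff_of_pos_right h3).1 hx

lemma aux_deriv (p : Polynomial ℝ) (h : 0 < p.leadingCoeff) (ε : ℝ) (hε : 0 < ε) :
    ∀ᶠ x : ℝ in atTop, |p.derivative.eval x| ≤ ε * p.eval x := by
  have h0 : p ≠ 0 := by rintro rfl; simp at h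
  have h1 := Polynomial.div_tendsto_zero_of_degree_lt p.derivative p
    (Polynomial.degree_derivative_lt h0)
  have h2 := h1.abs
  rw [abs_zero] at h2
  filter_upwards [h2.eventually (gt_mem_nhds hε), aux_pos p h] with x hx hx0
  rw [abs_div, abs_of_pos hx0, div_lt_iff₀ hx0] at hx
  exact hx.le

lemma aux_lead (s : Polynomial ℝ) (hdeg : 0 < s.natDegree) (hlead : 0 < s.leadingCoeff) :
    0 < s.derivative.leadingCoeff := by
  have : s.derivative.natDegree = s.natDegree - 1 := Polynomial.natDegree_derivative s
  rw [Polynomial.leadingCoeff, this, Polynomial.coeff_derivative,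
    Nat.sub_add_cancel hdeg]
  have : 0 < s.coeff s.natDegree := hlead
  positivity

lemma aux_summable (s : Polynomial ℝ) (hdeg : 0 < s.natDegree) (hlead : 0 < s.leadingCoeff)
    (t : ℝ) (ht : 0 < t) : Summable (fun n : ℕ => Real.exp (-t * s.eval (n : ℝ))) := by
  have hO : (fun x : ℝ => (Polynomial.X : Polynomial ℝ).eval x) =O[atTop] fun x => s.eval x := by
    apply Polynomial.isBigO_of_degree_le
    rw [Polynomial.degree_X]
    exact Polynomial.natDegree_pos_iff_degree_pos.1 hdeg |> Order.succ_le_of_lt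
  obtain ⟨C, hC, hb⟩ := hO.exists_pos
  have hb := (hb.bound.and (aux_pos s hlead))
  have hb := tendsto_natCast_atTop_atTop (R := ℝ) |>.eventually hb
  have hg : Summable (fun n : ℕ => Real.exp (-(t / C)) ^ n) := by
    apply summable_geometric_of_lt_one (Real.exp_pos _).le
    rw [Real.exp_lt_one_iff]
    have : 0 < t / C := by positivity
    linarith
  apply summable_of_isBigO_nat hg
  apply Asymptotics.IsBigO.of_bound 1
  filter_upwards [hb] with n hn
  obtain ⟨h1, h2⟩ := hn
  rw [one_mul, ← Real.exp_nat_mul, Real.norm_of_nonneg (Real.exp_pos _).le,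
    Real.norm_of_nonneg (Real.exp_pos _).le, Real.exp_le_exp]
  simp only [Polynomial.eval_X, Real.norm_eq_abs, Nat.abs_cast, abs_of_pos h2] at h1
  have : t * (n / C) ≤ t * s.eval (n : ℝ) := by
    apply mul_le_mul_of_nonneg_left _ ht.le
    rw [div_le_iff₀ hC]; linarith
  have e : (n : ℝ) * -(t / C) = - (t * (n / C)) := by ring
  rw [e]; linarith

lemma aux_alt (g : ℕ → ℝ) (hg : Summable g) :
    ∑' m : ℕ, (-1 : ℝ) ^ m * (g m - 2 * g (m + 1) + g (m + 2))
      = 4 * (∑' m : ℕ, (-1 : ℝ) ^ m * g m) - (3 * g 0 - g 1) := by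
  have key : ∀ g : ℕ → ℝ, Summable g → Summable (fun m : ℕ => (-1 : ℝ) ^ m * g m) := by
    intro g hg
    apply Summable.of_norm
    simpa [abs_mul] using hg.abs
  have hg1 : Summable (fun m => g (m + 1)) := (summable_nat_add_iff 1).2 hg
  have hg2 : Summable (fun m => g (m + 2)) := (summable_nat_add_iff 2).2 hg
  have step : ∀ g : ℕ → ℝ, Summable g → ∑' m : ℕ, (-1 : ℝ) ^ m * g (m + 1)
      = g 0 - ∑' m : ℕ, (-1 : ℝ) ^ m * g m := by
    intro g hg
    rw [(key g hg).tsum_eq_zero_add]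
    have : ∀ m : ℕ, (-1 : ℝ) ^ (m + 1) * g (m + 1) = -((-1) ^ m * g (m + 1)) := by
      intro m; ring
    simp_rw [this, tsum_neg]
    simp
  have e1 := step g hg
  have e2 := step (fun m => g (m + 1)) hg1
  simp only [zero_add, add_assoc, one_add_one_eq_two] at e2
  have : ∀ m : ℕ, (-1 : ℝ) ^ m * (g m - 2 * g (m + 1) + g (m + 2))
    = (-1 : ℝ) ^ m * g m - 2 * ((-1 : ℝ) ^ m * g (m + 1)) + (-1 : ℝ) ^ m * g (m + 2) := by
    intro m; ring
  simp_rw [this]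
  rw [Summable.tsum_add ((key _ hg).sub ((key _ hg1).mul_left 2)) (key _ hg2),
    Summable.tsum_sub (key _ hg) ((key _ hg1).mul_left 2), tsum_mul_left, e2, e1]
  ring

lemma aux_exp (u : ℝ) : u * Real.exp (-u / 2) ≤ 1 := by
  have h : u ≤ Real.exp (u / 2) := by
    by_cases hu : 0 ≤ u
    · have e : Real.exp (u / 2) = Real.exp (u / 4) ^ 2 := by
        rw [← Real.exp_nat_mul]; congr 1; push_cast; ring
      have h1 := Real.add_one_le_exp (u / 4)
      rw [e]
      nlinarith [sq_nonneg (u / 4 - 1)]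
    · linarith [Real.exp_pos (u / 2)]
  rw [neg_div, Real.exp_neg, ← div_eq_mul_inv, div_le_one (Real.exp_pos _)]
  exact h

lemma aux_second (s : Polynomial ℝ) (t ε N : ℝ) (ht : 0 < t) (hε : 0 < ε)
    (h0 : ∀ x ≥ N, 0 < s.eval x) (h1 : ∀ x ≥ N, 0 < s.derivative.eval x)
    (h2 : ∀ x ≥ N, |s.derivative.eval x| ≤ ε * s.eval x)
    (h3 : ∀ x ≥ N, |s.derivative.derivative.eval x| ≤ ε * s.derivative.eval x)
    (x : ℝ) (hx : N ≤ x) :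
    |Real.exp (-t * s.eval x) - 2 * Real.exp (-t * s.eval (x + 1))
      + Real.exp (-t * s.eval (x + 2))|
    ≤ 4 * ε * (Real.exp (-t * s.eval x / 2) - Real.exp (-t * s.eval (x + 2) / 2)) := by
  set f : ℝ → ℝ := fun x => Real.exp (-t * s.eval x) with hf
  set f' : ℝ → ℝ := fun x => Real.exp (-t * s.eval x) * (-t * s.derivative.eval x) with hf'
  set f'' : ℝ → ℝ := fun x => Real.exp (-t * s.eval x) * (-t * s.derivative.eval x) *
    (-t * s.derivative.eval x) + Real.exp (-t * s.eval x) * (-t * s.derivative.derivative.eval x)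
    with hf''
  set G : ℝ → ℝ := fun x => -(4 * ε * Real.exp (-t * s.eval x / 2)) with hG
  set G' : ℝ → ℝ := fun x => -(4 * ε * (Real.exp (-t * s.eval x / 2)
    * (-t * s.derivative.eval x / 2))) with hG'
  have df : ∀ x, HasDerivAt f (f' x) x := fun x =>
    ((s.hasDerivAt x).const_mul (-t)).exp
  have df' : ∀ x, HasDerivAt f' (f'' x) x := fun x =>
    (df x).mul ((s.derivative.hasDerivAt x).const_mul (-t))
  have dG : ∀ x, HasDerivAt G (G' x) x := fun x =>
    (((((s.hasDerivAt x).const_mul (-t)).div_const 2).exp).const_mul (4 * ε)).neg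
  have hle : ∀ x ≥ N, |f'' x| ≤ G' x := by
    intro x hx
    have a0 := h0 x hx
    have a1 := h1 x hx
    have a2 := h2 x hx
    have a3 := h3 x hx
    rw [abs_of_pos a1] at a2
    simp only [hf'', hG']
    set a := s.eval x
    set b := s.derivative.eval x
    set c := s.derivative.derivative.eval x
    have ee : Real.exp (-t * a) = Real.exp (-t * a / 2) * Real.exp (-t * a / 2) := by
      rw [← Real.exp_add]; congr 1; ring
    have hE : 0 < Real.exp (-t * a / 2) := Real.exp_pos _
    have hE1 : Real.exp (-t * a / 2) ≤ 1 := by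
      rw [Real.exp_le_one_iff]
      have : 0 < t * a := by positivity
      linarith
    have hu := aux_exp (t * a)
    rw [← neg_mul] at hu
    rw [ee]
    set E := Real.exp (-t * a / 2)
    have k1 : t * b * E ≤ ε := by
      calc t * b * E ≤ t * (ε * a) * E := by gcongr
        _ = ε * (t * a * E) := by ring
        _ ≤ ε * 1 := by gcongr
        _ = ε := mul_one _
    have k2 : E * E * (t * |c|) ≤ E * 1 * (t * (ε * b)) := by gcongr
    have k3 : (t * b * E) * (t * b * E) ≤ ε * (t * b * E) := by gcongr
    calc |E * E * (-t * b) * (-t * b) + E * E * (-t * c)|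
        ≤ |E * E * (-t * b) * (-t * b)| + |E * E * (-t * c)| := abs_add_le _ _
      _ = (t * b * E) * (t * b * E) + E * E * (t * |c|) := by
        simp only [abs_mul, abs_neg, abs_of_pos ht, abs_of_pos a1, abs_of_pos hE]; ring
      _ ≤ ε * (t * b * E) + E * 1 * (t * (ε * b)) := add_le_add k3 k2
      _ = _ := by ring
  have mono : ∀ F F' : ℝ → ℝ, (∀ x, HasDerivAt F (F' x) x) → (∀ x ≥ N, 0 ≤ F' x) →
      MonotoneOn F (Set.Ici N) := by
    intro F F' hF hp
    apply monotoneOn_of_hasDerivWithinAt_nonneg (f' := F') (convex_Ici N)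
    · exact fun x _ => (hF x).continuousAt.continuousWithinAt
    · exact fun x _ => (hF x).hasDerivWithinAt
    · intro x hx
      exact hp x (interior_subset hx)
  have m1 := mono (fun x => G x - f' x) (fun x => G' x - f'' x)
    (fun x => (dG x).sub (df' x)) (fun x hx => by linarith [le_abs_self (f'' x), hle x hx])
  have m2 := mono (fun x => G x + f' x) (fun x => G' x + f'' x)
    (fun x => (dG x).add (df' x)) (fun x hx => by linarith [neg_abs_le (f'' x), hle x hx])
  have m3 := mono G G' dG (fun x hx => (abs_nonneg _).trans (hle x hx))
  obtain ⟨ξ, ⟨l1, l2⟩, e1⟩ := exists_hasDerivAt_eq_slope f f' (show x < x + 1 by linarith)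
    (fun x _ => (df x).continuousAt.continuousWithinAt) (fun x _ => df x)
  obtain ⟨η, ⟨l3, l4⟩, e2⟩ := exists_hasDerivAt_eq_slope f f' (show x + 1 < x + 2 by linarith)
    (fun x _ => (df x).continuousAt.continuousWithinAt) (fun x _ => df x)
  rw [show x + 1 - x = 1 by ring, div_one] at e1
  rw [show x + 2 - (x + 1) = 1 by ring, div_one] at e2
  have n1 : ξ ∈ Set.Ici N := Set.mem_Ici.2 (by linarith)
  have n2 : η ∈ Set.Ici N := Set.mem_Ici.2 (by linarith)
  have n3 : x ∈ Set.Ici N := hx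
  have n4 : x + 2 ∈ Set.Ici N := Set.mem_Ici.2 (by linarith)
  have q1 := m1 n1 n2 (by linarith)
  have q2 := m2 n1 n2 (by linarith)
  have q3 := m3 n3 n1 (by linarith)
  have q4 := m3 n2 n4 (by linarith)
  have goal : |f x - 2 * f (x + 1) + f (x + 2)| ≤ G (x + 2) - G x := by
    simp only at q1 q2
    rw [abs_le]
    constructor <;> linarith
  refine goal.trans (le_of_eq ?_)
  simp only [hG]; ring

lemma aux_bound (s : Polynomial ℝ) (hdeg : 0 < s.natDegree) (hlead : 0 < s.leadingCoeff)
    (ε : ℝ) (hε : 0 < ε) : ∃ N : ℕ, ∀ t : ℝ, 0 < t →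
    |(∑' n : ℕ, (-1 : ℝ) ^ n * Real.exp (-t * s.eval (n : ℝ))) -
      (∑ n ∈ Finset.range N, (-1 : ℝ) ^ n * Real.exp (-t * s.eval (n : ℝ)) +
        (-1) ^ N * ((3 * Real.exp (-t * s.eval (N : ℝ))
          - Real.exp (-t * s.eval ((N + 1 : ℕ) : ℝ))) / 4))| ≤ 2 * ε := by
  have hl := aux_lead s hdeg hlead
  have ev := (((aux_pos s hlead).and (aux_pos _ hl)).and
    ((aux_deriv s hlead ε hε).and (aux_deriv _ hl ε hε)))
  obtain ⟨N₀, hN₀⟩ := eventually_atTop.1 ev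
  obtain ⟨N, hN⟩ := exists_nat_ge N₀
  refine ⟨N, fun t ht => ?_⟩
  have hN' : ∀ x : ℝ, x ≥ N → _ := fun x hx => hN₀ x (hN.trans hx)
  set f : ℕ → ℝ := fun n => Real.exp (-t * s.eval (n : ℝ)) with hf
  have hs : Summable f := aux_summable s hdeg hlead t ht
  have hs' : Summable (fun n : ℕ => (-1 : ℝ) ^ n * f n) := by
    apply Summable.of_norm
    simpa [abs_mul] using hs.abs
  set g : ℕ → ℝ := fun m => f (m + N) with hg
  have hgs : Summable g := (summable_nat_add_iff N).2 hs
  have halt := aux_alt g hgs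
  have hsplit := hs'.sum_add_tsum_nat_add N
  have htail : ∑' m : ℕ, (-1 : ℝ) ^ (m + N) * f (m + N)
      = (-1) ^ N * ∑' m : ℕ, (-1 : ℝ) ^ m * g m := by
    rw [← tsum_mul_left]
    congr 1; ext m; rw [pow_add]; simp only [hg]; ring
  set E : ℕ → ℝ := fun m => Real.exp (-t * s.eval ((m + N : ℕ) : ℝ) / 2) with hE
  have hb : ∀ m, |g m - 2 * g (m + 1) + g (m + 2)| ≤ 4 * ε * (E m - E (m + 2)) := by
    intro m
    have := aux_second s t ε N ht hε (fun x hx => (hN' x hx).1.1) (fun x hx => (hN' x hx).1.2)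
      (fun x hx => (hN' x hx).2.1) (fun x hx => (hN' x hx).2.2) ((m + N : ℕ) : ℝ)
      (by push_cast; linarith [(Nat.cast_nonneg m : (0 : ℝ) ≤ m)])
    have c1 : (((m + 1 + N : ℕ)) : ℝ) = ((m + N : ℕ) : ℝ) + 1 := by push_cast; ring
    have c2 : (((m + 2 + N : ℕ)) : ℝ) = ((m + N : ℕ) : ℝ) + 2 := by push_cast; ring
    simp only [hg, hf, hE, c1, c2]
    exact this
  have hE1 : ∀ m, E m ≤ 1 := by
    intro m
    simp only [hE]
    rw [Real.exp_le_one_iff]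
    have : 0 < s.eval ((m + N : ℕ) : ℝ) := (hN' ((m + N : ℕ) : ℝ)
      (by push_cast; linarith [(Nat.cast_nonneg m : (0 : ℝ) ≤ m)])).1.1
    have := mul_pos ht this
    linarith
  have hE0 : ∀ m, 0 < E m := fun m => Real.exp_pos _
  have hsum : ∀ M : ℕ, ∑ m ∈ Finset.range M, |g m - 2 * g (m + 1) + g (m + 2)|
      ≤ 4 * ε * (E 0 + E 1 - E M - E (M + 1)) := by
    intro M
    induction M with
    | zero => simp
    | succ M ih =>
      rw [Finset.sum_range_succ]
      have := hb M
      rw [show M + 1 + 1 = M + 2 from rfl]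
      nlinarith
  have hT : ∑' m, |g m - 2 * g (m + 1) + g (m + 2)| ≤ 8 * ε := by
    apply Real.tsum_le_of_sum_range_le (fun _ => abs_nonneg _)
    intro M
    refine (hsum M).trans ?_
    have := hE1 0; have := hE1 1; have := hE0 M; have := hE0 (M + 1)
    nlinarith
  have hS2 : Summable (fun m => |g m - 2 * g (m + 1) + g (m + 2)|) :=
    ((hgs.sub (((summable_nat_add_iff 1).2 hgs).mul_left 2)).add
      ((summable_nat_add_iff 2).2 hgs)).abs
  have hfin : |∑' m : ℕ, (-1 : ℝ) ^ m * (g m - 2 * g (m + 1) + g (m + 2))| ≤ 8 * ε := by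
    refine le_trans ?_ hT
    have := norm_tsum_le_tsum_norm
      (f := fun m : ℕ => (-1 : ℝ) ^ m * (g m - 2 * g (m + 1) + g (m + 2)))
      (by simpa [abs_mul] using hS2)
    simpa [abs_mul] using this
  rw [halt] at hfin
  have g0 : g 0 = f N := by simp [hg]
  have g1 : g 1 = f (N + 1) := by simp only [hg]; rw [add_comm]
  rw [g0, g1] at hfin
  change |(∑' n : ℕ, (-1 : ℝ) ^ n * f n) - (∑ n ∈ Finset.range N, (-1 : ℝ) ^ n * f n +
    (-1) ^ N * ((3 * f N - f (N + 1)) / 4))| ≤ 2 * ε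
  rw [← hsplit, htail]
  set T := ∑' m : ℕ, (-1 : ℝ) ^ m * g m
  have e : ∑ n ∈ Finset.range N, (-1 : ℝ) ^ n * f n + (-1) ^ N * T -
      (∑ n ∈ Finset.range N, (-1 : ℝ) ^ n * f n + (-1) ^ N * ((3 * f N - f (N + 1)) / 4))
      = (-1) ^ N * ((4 * T - (3 * f N - f (N + 1))) / 4) := by ring
  rw [e, abs_mul, abs_pow, abs_neg, abs_one, one_pow, one_mul, abs_div,
    abs_of_pos (show (0 : ℝ) < 4 by norm_num)]
  linarith

lemma aux_half (N : ℕ) : ∑ n ∈ Finset.range N, (-1 : ℝ) ^ n * 1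
    + (-1) ^ N * ((3 * 1 - 1) / 4) = 1 / 2 := by
  induction N with
  | zero => norm_num
  | succ N ih => rw [Finset.sum_range_succ, ← ih]; ring

/-- Corollary: if `s` is a real polynomial with positive degree and positive leading
coefficient, then `lim_{q→1⁻} Σ_{n≥0} (−1)^n q^{s(n)} = 1/2`. -/
theorem radial_limit_alternating
    (s : Polynomial ℝ) (hdeg : 0 < s.natDegree) (hlead : 0 < s.leadingCoeff) :
    Tendsto
      (fun q : ℝ => ∑' n : ℕ, (-1 : ℝ) ^ n * q ^ (s.eval (n : ℝ)))
      (𝓝[Set.Ioo (0 : ℝ) 1] 1) (𝓝 (1 / 2)) := by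
  rw [Metric.tendsto_nhds]
  intro δ hδ
  obtain ⟨N, hN⟩ := aux_bound s hdeg hlead (δ / 4) (by positivity)
  have hq : ∀ a : ℝ, Tendsto (fun q : ℝ => q ^ a) (𝓝[Set.Ioo (0 : ℝ) 1] 1) (𝓝 1) := by
    intro a
    have := (Real.continuousAt_rpow_const 1 a (Or.inl one_ne_zero)).tendsto
    rw [Real.one_rpow] at this
    exact this.mono_left nhdsWithin_le_nhds
  have hA : Tendsto (fun q : ℝ => ∑ n ∈ Finset.range N, (-1 : ℝ) ^ n * q ^ (s.eval (n : ℝ)) +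
        (-1) ^ N * ((3 * q ^ (s.eval (N : ℝ))
          - q ^ (s.eval ((N + 1 : ℕ) : ℝ))) / 4)) (𝓝[Set.Ioo (0 : ℝ) 1] 1) (𝓝 (1 / 2)) := by
    rw [← aux_half N]
    exact (tendsto_finsetSum _ fun n _ => (hq _).const_mul _).add
      (((((hq _).const_mul 3).sub (hq _)).div_const 4).const_mul _)
  rw [Metric.tendsto_nhds] at hA
  filter_upwards [hA (δ / 2) (by positivity), self_mem_nhdsWithin] with q h1 h2
  have h3 := hN (-Real.log q) (by linarith [Real.log_neg h2.1 h2.2])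
  simp only [neg_neg, ← Real.rpow_def_of_pos h2.1] at h3
  rw [Real.dist_eq] at h1 ⊢
  rw [abs_lt] at h1 ⊢
  rw [abs_le] at h3
  constructor <;> linarith
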